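/- Let γ be a generic smooth closed curve in ℝ³. Then the set of planes in X₂ that are not transverse to γ is a closed subset of X₂ whose complement has finitely many connected components; consequently the planes in X₂ transverse to γ fall into finitely many equivalence classes, and w₂(γ) is finite. -/

import Mathlib

open Real Set

noncomputable section

namespace KWidth

/-! ### Lines in the plane (equivalently, planes in `ℝ³` perpendicular to the `xy`-plane).
A triple `L = (a, b, c)` with `(a,b) ≠ (0,0)` represents the line `{a x + b y = c}` in `ℝ²`,
equivalently the vertical plane `{a x + b y = c}` in `ℝ³`. -/

def IsLine (L : ℝ × ℝ × ℝ) : Prop := (L.1, L.2.1) ≠ (0, 0)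

def lineSet (L : ℝ × ℝ × ℝ) : Set (ℝ × ℝ) := {p | L.1 * p.1 + L.2.1 * p.2 = L.2.2}

/-- The affine function whose zero set cuts out the line, evaluated along the curve. -/
def hFun (γ : ℝ → ℝ × ℝ) (L : ℝ × ℝ × ℝ) : ℝ → ℝ :=
  fun t => L.1 * (γ t).1 + L.2.1 * (γ t).2 - L.2.2

/-- Parameters (in one period) at which the curve meets the line. -/
def memParams (γ : ℝ → ℝ × ℝ) (L : ℝ × ℝ × ℝ) : Set ℝ :=
  {t | t ∈ Ico (0 : ℝ) 1 ∧ γ t ∈ lineSet L}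

/-- The width of a line: the number of intersection points with the closed curve `γ`
(of period one). -/
def lineWidth (γ : ℝ → ℝ × ℝ) (L : ℝ × ℝ × ℝ) : ℕ := Nat.card (memParams γ L)

/-- The line is transverse to the curve: at every intersection point the tangent line of the
curve is not contained in it. -/
def TransverseLine (γ : ℝ → ℝ × ℝ) (L : ℝ × ℝ × ℝ) : Prop :=
  IsLine L ∧ ∀ t : ℝ, γ t ∈ lineSet L → deriv (hFun γ L) t ≠ 0

/-- The line `L` is tangent to the curve at the parameter `t`. -/
def TangentAt (γ : ℝ → ℝ × ℝ) (L : ℝ × ℝ × ℝ) (t : ℝ) : Prop :=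
  IsLine L ∧ γ t ∈ lineSet L ∧ deriv (hFun γ L) t = 0

/-! ### Curvature of plane curves -/

def speed (γ : ℝ → ℝ × ℝ) (t : ℝ) : ℝ :=
  Real.sqrt ((deriv (fun s => (γ s).1) t) ^ 2 + (deriv (fun s => (γ s).2) t) ^ 2)

/-- Signed curvature of a regular plane curve (in an arbitrary regular parametrization). -/
def signedCurv (γ : ℝ → ℝ × ℝ) (t : ℝ) : ℝ :=
  (deriv (fun s => (γ s).1) t * deriv (deriv fun s => (γ s).2) t -
      deriv (fun s => (γ s).2) t * deriv (deriv fun s => (γ s).1) t) / speed γ t ^ 3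

/-- Total curvature of a closed plane curve of period one: the integral of the absolute value of
the curvature with respect to arc length. -/
def totalCurv (γ : ℝ → ℝ × ℝ) : ℝ := ∫ t in (0:ℝ)..1, |signedCurv γ t| * speed γ t

/-! ### Crossings, inflection points, double tangent lines -/

/-- `p` is a self-intersection (crossing) point of the closed curve `γ`. -/
def CrossingPt (γ : ℝ → ℝ × ℝ) (p : ℝ × ℝ) : Prop :=
  ∃ s ∈ Ico (0:ℝ) 1, ∃ t ∈ Ico (0:ℝ) 1, s ≠ t ∧ γ s = p ∧ γ t = p

def crossingCount (γ : ℝ → ℝ × ℝ) : ℕ := Nat.card {p | CrossingPt γ p}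

def inflectionParams (γ : ℝ → ℝ × ℝ) : Set ℝ := {t | t ∈ Ico (0:ℝ) 1 ∧ signedCurv γ t = 0}

def inflectionCount (γ : ℝ → ℝ × ℝ) : ℕ := Nat.card (inflectionParams γ)

/-- The set of points at which a given line is tangent to the curve. -/
def tangencyPts (γ : ℝ → ℝ × ℝ) (L : ℝ × ℝ × ℝ) : Set (ℝ × ℝ) :=
  {p | ∃ t ∈ Ico (0:ℝ) 1, TangentAt γ L t ∧ γ t = p}

/-- `L` is a double tangent line: it is tangent to the curve at exactly two points. -/
def IsDoubleTangent (γ : ℝ → ℝ × ℝ) (L : ℝ × ℝ × ℝ) : Prop :=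
  IsLine L ∧ ∃ p q : ℝ × ℝ, p ≠ q ∧ tangencyPts γ L = {p, q}

/-- A subset `ℓ ⊆ ℝ²` is a double tangent line of `γ`. -/
def IsDoubleTangentLine (γ : ℝ → ℝ × ℝ) (ℓ : Set (ℝ × ℝ)) : Prop :=
  ∃ L, lineSet L = ℓ ∧ IsDoubleTangent γ L

/-- An exterior double tangent line: the curve lies locally on the same side of the line at its
two points of tangency. -/
def IsExtDoubleTangentLine (γ : ℝ → ℝ × ℝ) (ℓ : Set (ℝ × ℝ)) : Prop :=
  ∃ L, lineSet L = ℓ ∧ IsDoubleTangent γ L ∧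
    ∃ s ∈ Ico (0:ℝ) 1, ∃ t ∈ Ico (0:ℝ) 1, γ s ≠ γ t ∧ TangentAt γ L s ∧ TangentAt γ L t ∧
      0 < deriv (deriv (hFun γ L)) s * deriv (deriv (hFun γ L)) t

/-- An interior double tangent line: the curve lies locally on opposite sides of the line at its
two points of tangency (the line separates neighborhoods of the tangency points). -/
def IsIntDoubleTangentLine (γ : ℝ → ℝ × ℝ) (ℓ : Set (ℝ × ℝ)) : Prop :=
  ∃ L, lineSet L = ℓ ∧ IsDoubleTangent γ L ∧
    ∃ s ∈ Ico (0:ℝ) 1, ∃ t ∈ Ico (0:ℝ) 1, γ s ≠ γ t ∧ TangentAt γ L s ∧ TangentAt γ L t ∧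
      deriv (deriv (hFun γ L)) s * deriv (deriv (hFun γ L)) t < 0

/-! ### Generic plane curves -/

/-- A generic (`C²`, immersed, closed) plane curve: finitely many self-intersections, all of them
transverse double points, finitely many inflection points, finitely many double tangent lines,
all of them nondegenerate, no line tangent to the curve at more than two points, and no tangent
line at an inflection point or double tangency passing through a crossing. -/
structure GenericPlane (γ : ℝ → ℝ × ℝ) : Prop where
  contDiff : ContDiff ℝ 2 γ
  periodic : Function.Periodic γ 1
  immersed : ∀ t, deriv γ t ≠ 0
  selfint_finite : {p : ℝ × ℝ | CrossingPt γ p}.Finite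
  crossings_transverse : ∀ s ∈ Ico (0:ℝ) 1, ∀ t ∈ Ico (0:ℝ) 1, s ≠ t → γ s = γ t →
    (deriv γ s).1 * (deriv γ t).2 - (deriv γ s).2 * (deriv γ t).1 ≠ 0
  no_triple_point : ∀ s ∈ Ico (0:ℝ) 1, ∀ t ∈ Ico (0:ℝ) 1, ∀ u ∈ Ico (0:ℝ) 1,
    γ s = γ t → γ t = γ u → s = t ∨ t = u ∨ s = u
  inflections_finite : (inflectionParams γ).Finite
  dbltangents_finite : {ℓ : Set (ℝ × ℝ) | IsDoubleTangentLine γ ℓ}.Finite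
  no_triple_tangent : ∀ L : ℝ × ℝ × ℝ, IsLine L → ∀ p ∈ tangencyPts γ L, ∀ q ∈ tangencyPts γ L,
    ∀ r ∈ tangencyPts γ L, p = q ∨ q = r ∨ p = r
  dbltangent_nondeg : ∀ L : ℝ × ℝ × ℝ, IsDoubleTangent γ L → ∀ t, TangentAt γ L t →
    deriv (deriv (hFun γ L)) t ≠ 0
  tangent_at_inflection_avoids_crossings : ∀ L : ℝ × ℝ × ℝ, ∀ t : ℝ, TangentAt γ L t →
    signedCurv γ t = 0 → ∀ p : ℝ × ℝ, CrossingPt γ p → p ∉ lineSet L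
  dbltangent_avoids_crossings : ∀ L : ℝ × ℝ × ℝ, IsDoubleTangent γ L →
    ∀ p : ℝ × ℝ, CrossingPt γ p → p ∉ lineSet L

/-! ### Equivalence classes of transverse lines and the 2-width -/

/-- Two lines are connected by a path of lines transverse to the curve `γ`. -/
def LineHomotopic (γ : ℝ → ℝ × ℝ) (L₀ L₁ : ℝ × ℝ × ℝ) : Prop :=
  ∃ P : ℝ → ℝ × ℝ × ℝ, ContinuousOn P (Icc 0 1) ∧ P 0 = L₀ ∧ P 1 = L₁ ∧
    ∀ s ∈ Icc (0:ℝ) 1, TransverseLine γ (P s)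

/-- The type of lines transverse to `γ`. -/
def TLine (γ : ℝ → ℝ × ℝ) := {L : ℝ × ℝ × ℝ // TransverseLine γ L}

def lineRel (γ : ℝ → ℝ × ℝ) : TLine γ → TLine γ → Prop :=
  fun L₀ L₁ => LineHomotopic γ L₀.val L₁.val

/-- Equivalence classes of lines transverse to `γ`. -/
def LineClasses (γ : ℝ → ℝ × ℝ) := Quot (lineRel γ)

/-- The 2-width of a closed plane curve: the sum, over the equivalence classes of transverse
lines, of the width of a representative line. -/
def w₂ (γ : ℝ → ℝ × ℝ) : ℕ := ∑ᶠ C : LineClasses γ, lineWidth γ (Quot.out C).val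

/-! ### Space curves -/

/-- Vertical projection `π : ℝ³ → ℝ²` applied to a space curve. -/
def proj (γ : ℝ → ℝ × ℝ × ℝ) : ℝ → ℝ × ℝ := fun t => ((γ t).1, (γ t).2.1)

/-- A smooth embedded closed curve in `ℝ³`, parametrized with period one. -/
def SmoothClosedCurve (γ : ℝ → ℝ × ℝ × ℝ) : Prop :=
  ContDiff ℝ (⊤ : ℕ∞) γ ∧ Function.Periodic γ 1 ∧ (∀ t, deriv γ t ≠ 0) ∧
    Set.InjOn γ (Ico (0:ℝ) 1)

/-- A generic smooth closed curve in `ℝ³`: smooth, embedded, no tangent line parallel to the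
`z`-axis, and the vertical projection is a generic plane curve. -/
def GenericSpace (γ : ℝ → ℝ × ℝ × ℝ) : Prop :=
  SmoothClosedCurve γ ∧ (∀ t, deriv (proj γ) t ≠ 0) ∧ GenericPlane (proj γ)

/-- A vertical plane `{a x + b y = c}` in `ℝ³` meets the curve `γ` exactly where the line
`{a x + b y = c}` in `ℝ²` meets `π(γ)`, and transversality/width agree; so the 2-width of a
space curve is the 2-width of its projection computed with lines in `ℝ²`. -/
def w₂Space (γ : ℝ → ℝ × ℝ × ℝ) : ℕ := w₂ (proj γ)

/-! ### Isotopy and knots -/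

/-- Smooth closed curves `γ₀, γ₁` in `ℝ³` are isotopic: one deforms to the other through smooth
embedded closed curves. -/
def Isotopic (γ₀ γ₁ : ℝ → ℝ × ℝ × ℝ) : Prop :=
  ∃ F : ℝ → ℝ → ℝ × ℝ × ℝ, Continuous (Function.uncurry F) ∧
    (∀ s ∈ Icc (0:ℝ) 1, SmoothClosedCurve (F s)) ∧ F 0 = γ₀ ∧ F 1 = γ₁

/-- The round unit circle in the `xy`-plane. -/
def roundCircle : ℝ → ℝ × ℝ × ℝ := fun t => (Real.cos (2 * π * t), Real.sin (2 * π * t), 0)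

/-- A curve is unknotted if it is isotopic to a round circle. -/
def Unknot (γ : ℝ → ℝ × ℝ × ℝ) : Prop := Isotopic γ roundCircle

/-- The `(p,q)`-torus curve on the standardly embedded torus in `ℝ³`, winding `p` times around
one generating circle and `q` times around the other. -/
def torusKnot (p q : ℤ) : ℝ → ℝ × ℝ × ℝ := fun t =>
  ((2 + Real.cos (2 * π * (q : ℝ) * t)) * Real.cos (2 * π * (p : ℝ) * t),
   (2 + Real.cos (2 * π * (q : ℝ) * t)) * Real.sin (2 * π * (p : ℝ) * t),
   Real.sin (2 * π * (q : ℝ) * t))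

/-- The 2-width of the knot (isotopy class) represented by `γ₀`: the minimum of the 2-widths of
its generic representatives. -/
def knotW2 (γ₀ : ℝ → ℝ × ℝ × ℝ) : ℕ :=
  sInf {w : ℕ | ∃ γ, GenericSpace γ ∧ Isotopic γ γ₀ ∧ w₂Space γ = w}

/-- Braid position: in cylindrical coordinates `γ(s) = (r(s), θ(s), z(s))` with `r > 0` and
`θ' > 0`. -/
def BraidPosition (γ : ℝ → ℝ × ℝ × ℝ) : Prop :=
  ∃ r θ z : ℝ → ℝ, ContDiff ℝ (⊤ : ℕ∞) r ∧ ContDiff ℝ (⊤ : ℕ∞) θ ∧ ContDiff ℝ (⊤ : ℕ∞) z ∧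
    (∀ t, 0 < r t) ∧ (∀ t, 0 < deriv θ t) ∧
    ∀ t, γ t = (r t * Real.cos (θ t), r t * Real.sin (θ t), z t)


/-! ### The space `X₂` as a topological space, the graphic, and the Möbius band -/

/-- Two parameter triples represent the same line iff they are proportional. -/
def lineSetoid : Setoid {L : ℝ × ℝ × ℝ // IsLine L} where
  r L L' := ∃ c : ℝ, c ≠ 0 ∧ L'.val = c • L.val
  iseqv := by
    refine ⟨fun L => ⟨1, one_ne_zero, (one_smul _ _).symm⟩, ?_, ?_⟩
    · rintro L M ⟨c, hc, h⟩
      exact ⟨c⁻¹, inv_ne_zero hc, by rw [h, smul_smul, inv_mul_cancel₀ hc, one_smul]⟩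
    · rintro L M N ⟨c, hc, h⟩ ⟨d, hd, h'⟩
      exact ⟨d * c, mul_ne_zero hd hc, by rw [h', h, smul_smul]⟩

/-- The space `X₂` of lines in the plane (equivalently, of planes in `ℝ³` perpendicular to the
`xy`-plane), an open Möbius band, with the quotient topology. -/
def X₂sp := Quotient lineSetoid

instance : TopologicalSpace X₂sp := instTopologicalSpaceQuotient

/-- The graphic of a curve: the set of all its tangent lines, as a subset of `X₂`. -/
def graphic (γ : ℝ → ℝ × ℝ) : Set X₂sp :=
  {x | ∃ L : {L : ℝ × ℝ × ℝ // IsLine L}, Quotient.mk lineSetoid L = x ∧ ∃ t : ℝ, TangentAt γ L.val t}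

/-- The set of lines (as points of `X₂`) that are *not* transverse to `γ`. -/
def nonTransverse (γ : ℝ → ℝ × ℝ) : Set X₂sp :=
  {x | ∃ L : {L : ℝ × ℝ × ℝ // IsLine L}, Quotient.mk lineSetoid L = x ∧ ¬ TransverseLine γ L.val}

/-- The standard open Möbius band: the quotient of `ℝ²` by `(x, y) ∼ (x + 1, -y)`. -/
def mobiusSetoid : Setoid (ℝ × ℝ) where
  r p q := ∃ k : ℤ, q.1 = p.1 + k ∧ q.2 = (-1 : ℝ) ^ k * p.2
  iseqv := by
    have hne : (-1 : ℝ) ≠ 0 := by norm_num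
    refine ⟨fun p => ⟨0, by simp⟩, ?_, ?_⟩
    · rintro p q ⟨k, h1, h2⟩
      refine ⟨-k, by rw [h1]; push_cast; ring, ?_⟩
      rw [h2, ← mul_assoc, ← zpow_add₀ hne]
      simp
    · rintro p q s ⟨k, h1, h2⟩ ⟨l, h3, h4⟩
      refine ⟨k + l, by rw [h3, h1]; push_cast; ring, ?_⟩
      rw [h4, h2, ← mul_assoc, ← zpow_add₀ hne, add_comm l k]

def MobiusBand := Quotient mobiusSetoid

instance : TopologicalSpace MobiusBand := instTopologicalSpaceQuotient

open Filter Topology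

/-! ### The pencil of height functions `x + m y` -/

/-- The height function on the curve whose level sets are the lines `x + m y = c`. -/
def height (γ : ℝ → ℝ × ℝ) (m t : ℝ) : ℝ := (γ t).1 + m * (γ t).2

/-- The derivative of the height function along the curve. -/
def heightDeriv (γ : ℝ → ℝ × ℝ) (m t : ℝ) : ℝ :=
  deriv (fun s => (γ s).1) t + m * deriv (fun s => (γ s).2) t

/-- The second derivative of the height function along the curve. -/
def heightDeriv₂ (γ : ℝ → ℝ × ℝ) (m t : ℝ) : ℝ :=
  deriv (deriv fun s => (γ s).1) t + m * deriv (deriv fun s => (γ s).2) t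

/-- `c` is a critical value of the height function of slope parameter `m`. -/
def CritValue (γ : ℝ → ℝ × ℝ) (m c : ℝ) : Prop :=
  ∃ t, heightDeriv γ m t = 0 ∧ height γ m t = c

/-- Slope parameters of tangent lines at inflection points and of double tangent lines. -/
def badSlopes (γ : ℝ → ℝ × ℝ) : Set ℝ :=
  {m | ∃ t, heightDeriv γ m t = 0 ∧ signedCurv γ t = 0} ∪ {m | ∃ c, IsDoubleTangent γ (1, m, c)}

/-- The transverse lines of the form `x + m y = c`, as pairs `(m, c)`. -/
def transSet (γ : ℝ → ℝ × ℝ) : Set (ℝ × ℝ) := {p | TransverseLine γ (1, p.1, p.2)}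

lemma isLine_one (m c : ℝ) : IsLine (1, m, c) := by simp [IsLine]

section Smooth

variable {γ : ℝ → ℝ × ℝ}

lemma contDiff_fst_comp (hγ : ContDiff ℝ 2 γ) : ContDiff ℝ 2 (fun s => (γ s).1) := hγ.fst

lemma contDiff_snd_comp (hγ : ContDiff ℝ 2 γ) : ContDiff ℝ 2 (fun s => (γ s).2) := hγ.snd

lemma contDiff_one_deriv {f : ℝ → ℝ} (hf : ContDiff ℝ 2 f) : ContDiff ℝ 1 (deriv f) := by
  have : ContDiff ℝ (1 + 1) f := by simpa [one_add_one_eq_two] using hf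
  exact (contDiff_succ_iff_deriv.1 this).2.2

lemma deriv_eq_prod (hγ : ContDiff ℝ 2 γ) (t : ℝ) :
    deriv γ t = (deriv (fun s => (γ s).1) t, deriv (fun s => (γ s).2) t) := by
  have h1 := ((contDiff_fst_comp hγ).differentiable (by norm_num) t).hasDerivAt
  have h2 := ((contDiff_snd_comp hγ).differentiable (by norm_num) t).hasDerivAt
  exact (h1.prodMk h2).deriv

lemma deriv_hFun (hγ : ContDiff ℝ 2 γ) (L : ℝ × ℝ × ℝ) (t : ℝ) :
    deriv (hFun γ L) t =
      L.1 * deriv (fun s => (γ s).1) t + L.2.1 * deriv (fun s => (γ s).2) t := by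
  have h1 := ((contDiff_fst_comp hγ).differentiable (by norm_num) t).hasDerivAt
  have h2 := ((contDiff_snd_comp hγ).differentiable (by norm_num) t).hasDerivAt
  exact (((h1.const_mul L.1).add (h2.const_mul L.2.1)).sub_const L.2.2).deriv

lemma continuous_height (hγ : ContDiff ℝ 2 γ) :
    Continuous fun p : ℝ × ℝ => height γ p.1 p.2 := by
  have h := hγ.continuous
  unfold height
  fun_prop

lemma continuous_heightDeriv (hγ : ContDiff ℝ 2 γ) :
    Continuous fun p : ℝ × ℝ => heightDeriv γ p.1 p.2 := by
  have h1 := (contDiff_one_deriv (contDiff_fst_comp hγ)).continuous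
  have h2 := (contDiff_one_deriv (contDiff_snd_comp hγ)).continuous
  unfold heightDeriv
  fun_prop

lemma continuous_heightDeriv₂ (hγ : ContDiff ℝ 2 γ) :
    Continuous fun p : ℝ × ℝ => heightDeriv₂ γ p.1 p.2 := by
  have h1 := (contDiff_one_deriv (contDiff_fst_comp hγ)).continuous_deriv (by norm_num)
  have h2 := (contDiff_one_deriv (contDiff_snd_comp hγ)).continuous_deriv (by norm_num)
  unfold heightDeriv₂
  fun_prop

lemma hasDerivAt_heightDeriv (hγ : ContDiff ℝ 2 γ) (m t : ℝ) :
    HasDerivAt (heightDeriv γ m) (heightDeriv₂ γ m t) t := by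
  have h1 := ((contDiff_one_deriv (contDiff_fst_comp hγ)).differentiable (by norm_num) t).hasDerivAt
  have h2 := ((contDiff_one_deriv (contDiff_snd_comp hγ)).differentiable (by norm_num) t).hasDerivAt
  exact h1.add (h2.const_mul m)

lemma deriv_periodic {f : ℝ → ℝ} (hf : Function.Periodic f 1) :
    Function.Periodic (deriv f) 1 := by
  intro t
  rw [← deriv_comp_add_const]
  congr 1
  exact funext hf

lemma height_periodic (hγ : Function.Periodic γ 1) (m : ℝ) :
    Function.Periodic (height γ m) 1 := fun t => by simp [height, hγ t]

lemma heightDeriv_periodic (hγ : Function.Periodic γ 1) (m : ℝ) :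
    Function.Periodic (heightDeriv γ m) 1 := fun t => by
  have h1 : Function.Periodic (fun s => (γ s).1) 1 := fun s => by simp [hγ s]
  have h2 : Function.Periodic (fun s => (γ s).2) 1 := fun s => by simp [hγ s]
  simp [heightDeriv, deriv_periodic h1 t, deriv_periodic h2 t]

lemma signedCurv_periodic (hγ : Function.Periodic γ 1) :
    Function.Periodic (signedCurv γ) 1 := fun t => by
  have h1 : Function.Periodic (fun s => (γ s).1) 1 := fun s => by simp [hγ s]
  have h2 : Function.Periodic (fun s => (γ s).2) 1 := fun s => by simp [hγ s]
  simp [signedCurv, speed, deriv_periodic h1 t, deriv_periodic h2 t,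
    deriv_periodic (deriv_periodic h1) t, deriv_periodic (deriv_periodic h2) t]

lemma apply_fract {α : Type*} {f : ℝ → α} (hf : Function.Periodic f 1) (t : ℝ) :
    f (Int.fract t) = f t := by
  rw [Int.fract, ← mul_one (⌊t⌋ : ℝ)]
  exact hf.sub_int_mul_eq ⌊t⌋

lemma fract_mem_Ico (t : ℝ) : Int.fract t ∈ Ico (0 : ℝ) 1 :=
  ⟨Int.fract_nonneg t, Int.fract_lt_one t⟩

lemma fract_mem_Icc (t : ℝ) : Int.fract t ∈ Icc (0 : ℝ) 1 :=
  Ico_subset_Icc_self (fract_mem_Ico t)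

lemma CritValue.exists_mem_Icc (hγ : Function.Periodic γ 1) {m c : ℝ} (h : CritValue γ m c) :
    ∃ t ∈ Icc (0 : ℝ) 1, heightDeriv γ m t = 0 ∧ height γ m t = c := by
  obtain ⟨t, h1, h2⟩ := h
  exact ⟨Int.fract t, fract_mem_Icc t, by rw [apply_fract (heightDeriv_periodic hγ m), h1],
    by rw [apply_fract (height_periodic hγ m), h2]⟩

lemma tangentAt_one_iff (hγ : ContDiff ℝ 2 γ) (m c t : ℝ) :
    TangentAt γ (1, m, c) t ↔ heightDeriv γ m t = 0 ∧ height γ m t = c := by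
  simp [TangentAt, isLine_one, deriv_hFun hγ, lineSet, height, heightDeriv, and_comm]

lemma mem_transSet_iff (hγ : ContDiff ℝ 2 γ) (m c : ℝ) :
    (m, c) ∈ transSet γ ↔ ¬ CritValue γ m c := by
  simp only [transSet, mem_ofPred_eq, TransverseLine, isLine_one, deriv_hFun hγ, lineSet, CritValue,
    true_and, one_mul, height, heightDeriv, not_exists, not_and]
  exact forall_congr' fun t => ⟨fun h a b => h b a, fun h a b => h b a⟩

end Smooth

section Topological

variable {γ : ℝ → ℝ × ℝ}

/-- Transversality is an open condition. -/
lemma isOpen_transverse (hγ : ContDiff ℝ 2 γ) (hp : Function.Periodic γ 1) :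
    IsOpen {L | TransverseLine γ L} := by
  have hx := hγ.continuous
  have h1 := (contDiff_one_deriv (contDiff_fst_comp hγ)).continuous
  have h2 := (contDiff_one_deriv (contDiff_snd_comp hγ)).continuous
  have h1p : Function.Periodic (deriv fun s => (γ s).1) 1 :=
    deriv_periodic fun s => by simp [hp s]
  have h2p : Function.Periodic (deriv fun s => (γ s).2) 1 :=
    deriv_periodic fun s => by simp [hp s]
  have key : IsOpen {p : (ℝ × ℝ × ℝ) × ℝ | p.1.1 * (γ p.2).1 + p.1.2.1 * (γ p.2).2 ≠ p.1.2.2 ∨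
      p.1.1 * deriv (fun s => (γ s).1) p.2 + p.1.2.1 * deriv (fun s => (γ s).2) p.2 ≠ 0} :=
    (isOpen_ne_fun (by fun_prop) (by fun_prop)).union (isOpen_ne_fun (by fun_prop) (by fun_prop))
  have hline : IsOpen {L : ℝ × ℝ × ℝ | IsLine L} :=
    isOpen_ne_fun (by fun_prop) (by fun_prop)
  rw [isOpen_iff_eventually]
  rintro L ⟨hL, hT⟩
  have hev := (isCompact_Icc (a := (0 : ℝ)) (b := 1)).eventually_forall_of_forall_eventually
    (x₀ := L) (P := fun L t => L.1 * (γ t).1 + L.2.1 * (γ t).2 ≠ L.2.2 ∨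
      L.1 * deriv (fun s => (γ s).1) t + L.2.1 * deriv (fun s => (γ s).2) t ≠ 0) (by
    intro t _
    refine key.eventually_mem ?_
    by_cases h : L.1 * (γ t).1 + L.2.1 * (γ t).2 = L.2.2
    · right
      have := hT t h
      rwa [deriv_hFun hγ] at this
    · exact Or.inl h)
  filter_upwards [hev, hline.eventually_mem hL] with M hM hM'
  refine ⟨hM', fun t ht => ?_⟩
  rw [deriv_hFun hγ]
  have := hM (Int.fract t) (fract_mem_Icc t)
  rw [apply_fract hp, apply_fract h1p, apply_fract h2p] at this
  exact this.resolve_left (not_not.2 ht)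

lemma isOpen_transSet (hγ : ContDiff ℝ 2 γ) (hp : Function.Periodic γ 1) :
    IsOpen (transSet γ) :=
  (isOpen_transverse hγ hp).preimage (f := fun p : ℝ × ℝ => ((1 : ℝ), p.1, p.2)) (by fun_prop)

lemma TransverseLine.smul (hγ : ContDiff ℝ 2 γ) {L : ℝ × ℝ × ℝ} (h : TransverseLine γ L) {a : ℝ}
    (ha : a ≠ 0) : TransverseLine γ (a • L) := by
  obtain ⟨h1, h2⟩ := h
  refine ⟨by simpa [IsLine, ha] using h1, fun t ht => ?_⟩
  have ht' : γ t ∈ lineSet L := by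
    simp only [lineSet, mem_ofPred_eq, Prod.smul_fst, Prod.smul_snd, smul_eq_mul] at ht ⊢
    exact mul_left_cancel₀ ha (by linarith)
  have := h2 t ht'
  rw [deriv_hFun hγ] at this ⊢
  simp only [Prod.smul_fst, Prod.smul_snd, smul_eq_mul]
  rw [mul_assoc, mul_assoc, ← mul_add]
  exact mul_ne_zero ha this

end Topological

section Generic

variable {γ : ℝ → ℝ × ℝ}

lemma lineSet_one_injective :
    Function.Injective fun p : ℝ × ℝ => lineSet (1, p.1, p.2) := by
  rintro ⟨m, c⟩ ⟨m', c'⟩ h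
  have h0 : ((c, 0) : ℝ × ℝ) ∈ lineSet (1, m', c') := by
    rw [← show lineSet (1, m, c) = lineSet (1, m', c') from h]
    simp [lineSet]
  have h1 : ((c - m, 1) : ℝ × ℝ) ∈ lineSet (1, m', c') := by
    rw [← show lineSet (1, m, c) = lineSet (1, m', c') from h]
    simp [lineSet]
  simp only [lineSet, mem_ofPred_eq] at h0 h1
  ext <;> simp only <;> linarith

lemma GenericPlane.finite_badSlopes (h : GenericPlane γ) : (badSlopes γ).Finite := by
  refine Set.Finite.union ?_ ?_
  · refine (h.inflections_finite.image fun t =>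
      -deriv (fun s => (γ s).1) t / deriv (fun s => (γ s).2) t).subset ?_
    rintro m ⟨t, ht, hk⟩
    rw [← apply_fract (heightDeriv_periodic h.periodic m)] at ht
    rw [← apply_fract (signedCurv_periodic h.periodic)] at hk
    refine ⟨Int.fract t, ⟨fract_mem_Ico t, hk⟩, ?_⟩
    have him := h.immersed (Int.fract t)
    rw [deriv_eq_prod h.contDiff] at him
    unfold heightDeriv at ht
    have hy : deriv (fun s => (γ s).2) (Int.fract t) ≠ 0 := by
      intro hy
      rw [hy, mul_zero, add_zero] at ht
      exact him (by rw [hy, ht]; rfl)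
    simp only
    rw [div_eq_iff hy]
    linarith
  · have hfin : {p : ℝ × ℝ | IsDoubleTangent γ (1, p.1, p.2)}.Finite :=
      (h.dbltangents_finite.preimage lineSet_one_injective.injOn).subset
        fun p hp => ⟨_, rfl, hp⟩
    refine (hfin.image Prod.fst).subset ?_
    rintro m ⟨c, hc⟩
    exact ⟨(m, c), hc, rfl⟩

lemma heightDeriv₂_ne_zero {m t : ℝ} (hm : m ∉ badSlopes γ) (ht : heightDeriv γ m t = 0) :
    heightDeriv₂ γ m t ≠ 0 := by
  intro h2
  refine hm (Or.inl ⟨t, ht, ?_⟩)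
  unfold heightDeriv at ht
  unfold heightDeriv₂ at h2
  rw [signedCurv, div_eq_zero_iff]
  left
  rw [eq_neg_of_add_eq_zero_left ht, eq_neg_of_add_eq_zero_left h2]
  ring

/-- At a good slope, each critical value is attained at one critical point only. -/
lemma GenericPlane.exists_int_of_critical (h : GenericPlane γ) {m t t' : ℝ}
    (hm : m ∉ badSlopes γ) (ht : heightDeriv γ m t = 0) (ht' : heightDeriv γ m t' = 0)
    (heq : height γ m t = height γ m t') : ∃ k : ℤ, t' = t + k := by
  have hd := heightDeriv_periodic h.periodic m
  have hh := height_periodic h.periodic m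
  rw [← apply_fract hd] at ht ht'
  rw [← apply_fract hh t, ← apply_fract hh t'] at heq
  by_cases hne : Int.fract t = Int.fract t'
  · refine ⟨⌊t'⌋ - ⌊t⌋, ?_⟩
    have h1 := Int.floor_add_fract t
    have h2 := Int.floor_add_fract t'
    push_cast
    linarith
  exfalso
  by_cases hγ : γ (Int.fract t) = γ (Int.fract t')
  · refine h.crossings_transverse _ (fract_mem_Ico t) _ (fract_mem_Ico t') hne hγ ?_
    rw [deriv_eq_prod h.contDiff, deriv_eq_prod h.contDiff]
    unfold heightDeriv at ht ht'
    simp only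
    rw [eq_neg_of_add_eq_zero_left ht, eq_neg_of_add_eq_zero_left ht']
    ring
  · refine hm (Or.inr ⟨height γ m (Int.fract t), isLine_one _ _, _, _, hγ, ?_⟩)
    have hp : γ (Int.fract t) ∈ tangencyPts γ (1, m, height γ m (Int.fract t)) :=
      ⟨_, fract_mem_Ico t, (tangentAt_one_iff h.contDiff _ _ _).2 ⟨ht, rfl⟩, rfl⟩
    have hq : γ (Int.fract t') ∈ tangencyPts γ (1, m, height γ m (Int.fract t)) :=
      ⟨_, fract_mem_Ico t', (tangentAt_one_iff h.contDiff _ _ _).2 ⟨ht', heq.symm⟩, rfl⟩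
    refine Subset.antisymm (fun r hr => ?_) (insert_subset hp (singleton_subset_iff.2 hq))
    rcases h.no_triple_tangent _ (isLine_one _ _) _ hp _ hq _ hr with h1 | h1 | h1
    · exact absurd h1 hγ
    · exact Or.inr h1.symm
    · exact Or.inl h1.symm

/-- Nondegenerate critical points are locally unique, uniformly in the slope. -/
lemma eventually_critical_unique (hγ : ContDiff ℝ 2 γ) {m₀ t₀ : ℝ}
    (h₀ : heightDeriv₂ γ m₀ t₀ ≠ 0) :
    ∀ᶠ z : ℝ × ℝ × ℝ in 𝓝 (m₀, t₀, t₀),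
      heightDeriv γ z.1 z.2.1 = 0 → heightDeriv γ z.1 z.2.2 = 0 → z.2.1 = z.2.2 := by
  have hev : ∀ᶠ p : ℝ × ℝ in 𝓝 (m₀, t₀), heightDeriv₂ γ p.1 p.2 ≠ 0 :=
    (continuous_heightDeriv₂ hγ).continuousAt.eventually_ne h₀
  obtain ⟨ε, hε, hball⟩ := Metric.eventually_nhds_iff_ball.1 hev
  filter_upwards [Metric.ball_mem_nhds (m₀, t₀, t₀) hε]
  rintro ⟨m, s, s'⟩ hz h1 h2
  simp only [← ball_prod_same, mem_prod, Real.ball_eq_Ioo] at hz hball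
  by_contra hne
  wlog hlt : s < s' generalizing s s'
  · exact this s' s h2 h1 ⟨hz.1, hz.2.2, hz.2.1⟩ (Ne.symm hne)
      (lt_of_le_of_ne (not_lt.1 hlt) (Ne.symm hne))
  obtain ⟨u, hu, hu0⟩ := exists_hasDerivAt_eq_zero hlt
    (fun u _ => (hasDerivAt_heightDeriv hγ m u).continuousAt.continuousWithinAt)
    (h1.trans h2.symm) (fun u _ => hasDerivAt_heightDeriv hγ m u)
  exact hball (m, u) ⟨hz.1, hz.2.1.1.trans hu.1, hu.2.trans hz.2.2.2⟩ hu0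

/-- Near a point over a good slope there is at most one critical value for each slope. -/
lemma GenericPlane.eventually_critValue_unique (h : GenericPlane γ) {m₀ : ℝ}
    (hm : m₀ ∉ badSlopes γ) (c₀ : ℝ) :
    ∀ᶠ z : ℝ × ℝ × ℝ in 𝓝 (m₀, c₀, c₀),
      CritValue γ z.1 z.2.1 → CritValue γ z.1 z.2.2 → z.2.1 = z.2.2 := by
  have hd := continuous_heightDeriv h.contDiff
  have hh := continuous_height h.contDiff
  have hev := ((isCompact_Icc (a := (0 : ℝ)) (b := 1)).prod
    (isCompact_Icc (a := (0 : ℝ)) (b := 1))).eventually_forall_of_forall_eventually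
    (x₀ := (m₀, c₀, c₀)) (P := fun z q => heightDeriv γ z.1 q.1 = 0 → height γ z.1 q.1 = z.2.1 →
      heightDeriv γ z.1 q.2 = 0 → height γ z.1 q.2 = z.2.2 → z.2.1 = z.2.2) (by
    rintro ⟨t, t'⟩ -
    by_cases h1 : heightDeriv γ m₀ t = 0
    swap
    · have : ContinuousAt (fun z : (ℝ × ℝ × ℝ) × ℝ × ℝ => heightDeriv γ z.1.1 z.2.1)
          ((m₀, c₀, c₀), t, t') :=
        (hd.comp (f := fun z : (ℝ × ℝ × ℝ) × ℝ × ℝ => (z.1.1, z.2.1)) (by fun_prop)).continuousAt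
      filter_upwards [this.eventually_ne h1] with z hz a using absurd a hz
    by_cases h2 : height γ m₀ t = c₀
    swap
    · have : ContinuousAt (fun z : (ℝ × ℝ × ℝ) × ℝ × ℝ => height γ z.1.1 z.2.1 - z.1.2.1)
          ((m₀, c₀, c₀), t, t') :=
        ((hh.comp (f := fun z : (ℝ × ℝ × ℝ) × ℝ × ℝ => (z.1.1, z.2.1))
          (by fun_prop)).sub (by fun_prop)).continuousAt
      filter_upwards [this.eventually_ne (sub_ne_zero.2 h2)] with z hz _ a
        using absurd (sub_eq_zero.2 a) hz
    by_cases h3 : heightDeriv γ m₀ t' = 0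
    swap
    · have : ContinuousAt (fun z : (ℝ × ℝ × ℝ) × ℝ × ℝ => heightDeriv γ z.1.1 z.2.2)
          ((m₀, c₀, c₀), t, t') :=
        (hd.comp (f := fun z : (ℝ × ℝ × ℝ) × ℝ × ℝ => (z.1.1, z.2.2)) (by fun_prop)).continuousAt
      filter_upwards [this.eventually_ne h3] with z hz _ _ a using absurd a hz
    by_cases h4 : height γ m₀ t' = c₀
    swap
    · have : ContinuousAt (fun z : (ℝ × ℝ × ℝ) × ℝ × ℝ => height γ z.1.1 z.2.2 - z.1.2.2)
          ((m₀, c₀, c₀), t, t') :=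
        ((hh.comp (f := fun z : (ℝ × ℝ × ℝ) × ℝ × ℝ => (z.1.1, z.2.2))
          (by fun_prop)).sub (by fun_prop)).continuousAt
      filter_upwards [this.eventually_ne (sub_ne_zero.2 h4)] with z hz _ _ _ a
        using absurd (sub_eq_zero.2 a) hz
    obtain ⟨k, rfl⟩ := h.exists_int_of_critical hm h1 h3 (h2.trans h4.symm)
    have hcont : Tendsto (fun z : (ℝ × ℝ × ℝ) × ℝ × ℝ => (z.1.1, z.2.1, z.2.2 - (k : ℝ)))
        (𝓝 ((m₀, c₀, c₀), t, t + k)) (𝓝 (m₀, t, t)) := by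
      have : Continuous (fun z : (ℝ × ℝ × ℝ) × ℝ × ℝ => (z.1.1, z.2.1, z.2.2 - (k : ℝ))) := by
        fun_prop
      simpa using this.tendsto ((m₀, c₀, c₀), t, t + (k : ℝ))
    filter_upwards [hcont.eventually (eventually_critical_unique h.contDiff
      (heightDeriv₂_ne_zero hm h1))] with z hz a1 a2 a3 a4
    have hs := hz a1 (by
      have := (heightDeriv_periodic h.periodic z.1.1).sub_int_mul_eq (x := z.2.2) k
      rw [mul_one] at this
      exact this.trans a3)
    have := (height_periodic h.periodic z.1.1).sub_int_mul_eq (x := z.2.2) k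
    rw [mul_one] at this
    rw [← a2, ← a4, ← this, hs])
  filter_upwards [hev] with z hz hc hc'
  obtain ⟨t, ht, h1, h2⟩ := hc.exists_mem_Icc h.periodic
  obtain ⟨t', ht', h3, h4⟩ := hc'.exists_mem_Icc h.periodic
  exact hz (t, t') ⟨ht, ht'⟩ h1 h2 h3 h4

/-- Critical values are bounded, locally uniformly in the slope. -/
lemma GenericPlane.exists_critValue_bound (h : GenericPlane γ) (m₀ : ℝ) :
    ∃ C, ∀ m, |m - m₀| ≤ 1 → ∀ c, CritValue γ m c → |c| ≤ C := by
  obtain ⟨C, hC⟩ := ((isCompact_Icc (a := m₀ - 1) (b := m₀ + 1)).prod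
    (isCompact_Icc (a := (0 : ℝ)) (b := 1))).exists_bound_of_continuousOn
      (continuous_height h.contDiff).continuousOn
  refine ⟨C, fun m hm c hc => ?_⟩
  obtain ⟨t, ht, -, rfl⟩ := hc.exists_mem_Icc h.periodic
  rw [abs_le] at hm
  exact hC (m, t) ⟨⟨by linarith, by linarith⟩, ht⟩

lemma GenericPlane.finite_critValue (h : GenericPlane γ) {m : ℝ} (hm : m ∉ badSlopes γ) :
    {c | CritValue γ m c}.Finite := by
  obtain ⟨C, hC⟩ := h.exists_critValue_bound m
  have hloc : ∀ c₀ : ℝ, ∃ U ∈ 𝓝 c₀, ({c | CritValue γ m c} ∩ U).Subsingleton := by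
    intro c₀
    have hcont : Tendsto (fun z : ℝ × ℝ => (m, z.1, z.2)) (𝓝 (c₀, c₀)) (𝓝 (m, c₀, c₀)) :=
      (by fun_prop : Continuous fun z : ℝ × ℝ => (m, z.1, z.2)).tendsto _
    have hev := hcont.eventually (h.eventually_critValue_unique hm c₀)
    obtain ⟨ε, hε, hball⟩ := Metric.eventually_nhds_iff_ball.1 hev
    refine ⟨Metric.ball c₀ ε, Metric.ball_mem_nhds _ hε, ?_⟩
    rintro c ⟨hc, hcU⟩ c' ⟨hc', hcU'⟩
    exact hball (c, c') (by rw [← ball_prod_same]; exact ⟨hcU, hcU'⟩) hc hc'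
  choose U hU hsub using hloc
  obtain ⟨F, -, hF⟩ := (isCompact_Icc (a := -C) (b := C)).elim_nhds_subcover U fun c _ => hU c
  refine (F.finite_toSet.biUnion fun c _ => (hsub c).finite).subset fun c hc => ?_
  have hcC := hF (abs_le.1 (hC m (by simp) c hc))
  simp only [mem_iUnion] at hcC ⊢
  obtain ⟨c₀, hc₀, hcU⟩ := hcC
  exact ⟨c₀, hc₀, hc, hcU⟩

end Generic

section Joining

lemma joinedIn_of_horizontal {W : Set (ℝ × ℝ)} {m m' c : ℝ}
    (h : ∀ x ∈ uIcc m m', (x, c) ∈ W) : JoinedIn W (m, c) (m', c) := by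
  refine JoinedIn.of_segment_subset ?_
  rw [← Prod.image_mk_segment_left, segment_eq_uIcc]
  rintro _ ⟨x, hx, rfl⟩
  exact h x hx

lemma joinedIn_of_vertical {W : Set (ℝ × ℝ)} {m c c' : ℝ}
    (h : ∀ x ∈ uIcc c c', (m, x) ∈ W) : JoinedIn W (m, c) (m, c') := by
  refine JoinedIn.of_segment_subset ?_
  rw [← Prod.image_mk_segment_right, segment_eq_uIcc]
  rintro _ ⟨x, hx, rfl⟩
  exact h x hx

/-- A finite set of reals divides its complement into finitely many intervals. -/
lemma exists_finite_reps {B : Set ℝ} (hB : B.Finite) :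
    ∃ R : Set ℝ, R.Finite ∧ ∀ m ∉ B, ∃ r ∈ R, Disjoint (uIcc m r) B := by
  classical
  let f : ℝ → Set ℝ := fun m => {b ∈ B | b < m}
  have hfin : (f '' Bᶜ).Finite :=
    hB.finite_subsets.subset (by rintro _ ⟨m, -, rfl⟩; exact fun b hb => hb.1)
  obtain ⟨R, hRB, hR, hfR⟩ := exists_subset_image_finite_and.1 ⟨_, Subset.rfl, hfin, rfl⟩
  refine ⟨R, hR, fun m hm => ?_⟩
  obtain ⟨r, hr, hrm⟩ : f m ∈ f '' R := hfR ▸ mem_image_of_mem f hm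
  refine ⟨r, hr, disjoint_left.2 fun b hb hbB => ?_⟩
  have hbm : b ≠ m := fun h => hm (h ▸ hbB)
  have hbr : b ≠ r := fun h => hRB hr (h ▸ hbB)
  have hiff : b < r ↔ b < m := by
    have := Set.ext_iff.1 hrm b
    simpa [f, hbB] using this
  rcases mem_uIcc.1 hb with ⟨h1, h2⟩ | ⟨h1, h2⟩
  · exact absurd (hiff.1 (lt_of_le_of_ne h2 hbr)) (not_lt.2 h1)
  · exact absurd (hiff.2 (lt_of_le_of_ne h2 hbm)) (not_lt.2 h1)

variable {γ : ℝ → ℝ × ℝ}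

/-- If `(m₀, c)` is transverse, then so is the horizontal segment from `(m, c)` to `(m₀, c)` for
all `m` near `m₀`. -/
lemma GenericPlane.eventually_horizontal (h : GenericPlane γ) {m₀ c : ℝ}
    (hc : (m₀, c) ∈ transSet γ) :
    ∀ᶠ m in 𝓝 m₀, JoinedIn (transSet γ) (m, c) (m₀, c) := by
  have hev : ∀ᶠ m in 𝓝 m₀, (m, c) ∈ transSet γ :=
    ((isOpen_transSet h.contDiff h.periodic).preimage
      (by fun_prop : Continuous fun m : ℝ => (m, c))).eventually_mem hc
  obtain ⟨ε, hε, hball⟩ := Metric.eventually_nhds_iff_ball.1 hev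
  filter_upwards [Metric.ball_mem_nhds m₀ hε] with m hm
  exact joinedIn_of_horizontal fun x hx => hball x
    ((convex_ball m₀ ε).ordConnected.uIcc_subset hm (Metric.mem_ball_self hε) hx)

/-- Near any point over a good slope `m₀`, transverse lines can be joined to transverse lines of
slope `m₀`. -/
lemma GenericPlane.eventually_joined_local (h : GenericPlane γ) {m₀ : ℝ}
    (hm : m₀ ∉ badSlopes γ) (c₀ : ℝ) :
    ∀ᶠ z : ℝ × ℝ in 𝓝 (m₀, c₀), z ∈ transSet γ →
      ∃ c', JoinedIn (transSet γ) z (m₀, c') := by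
  have hW := isOpen_transSet h.contDiff h.periodic
  by_cases hc₀ : (m₀, c₀) ∈ transSet γ
  · obtain ⟨ε, hε, hball⟩ := Metric.isOpen_iff.1 hW _ hc₀
    filter_upwards [Metric.ball_mem_nhds _ hε] with z hz _
    exact ⟨c₀, JoinedIn.of_segment_subset
      (((convex_ball _ ε).segment_subset hz (Metric.mem_ball_self hε)).trans hball)⟩
  rw [mem_transSet_iff h.contDiff, not_not] at hc₀
  obtain ⟨ε, hε, hball⟩ :=
    Metric.eventually_nhds_iff_ball.1 (h.eventually_critValue_unique hm c₀)
  have huniq : ∀ m ∈ Metric.ball m₀ ε, ∀ c ∈ Metric.ball c₀ ε, ∀ c' ∈ Metric.ball c₀ ε,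
      CritValue γ m c → CritValue γ m c' → c = c' := fun m hm c hc c' hc' =>
    hball (m, c, c') (by simp only [← ball_prod_same]; exact ⟨hm, hc, hc'⟩)
  have hside : ∀ c ∈ Metric.ball c₀ ε, c ≠ c₀ → (m₀, c) ∈ transSet γ := by
    intro c hc hne
    rw [mem_transSet_iff h.contDiff]
    exact fun hcrit => hne (huniq m₀ (Metric.mem_ball_self hε) c hc c₀
      (Metric.mem_ball_self hε) hcrit hc₀)
  have hup : c₀ + ε / 2 ∈ Metric.ball c₀ ε := by
    rw [Real.ball_eq_Ioo]; constructor <;> linarith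
  have hdown : c₀ - ε / 2 ∈ Metric.ball c₀ ε := by
    rw [Real.ball_eq_Ioo]; constructor <;> linarith
  have hJ := (h.eventually_horizontal (hside _ hup (by linarith))).and
    ((h.eventually_horizontal (hside _ hdown (by linarith))).and (Metric.ball_mem_nhds m₀ hε))
  have hK : ∀ᶠ c in 𝓝 c₀, c ∈ Metric.ball c₀ (ε / 2) := Metric.ball_mem_nhds c₀ (half_pos hε)
  rw [nhds_prod_eq]
  filter_upwards [hJ.prod_mk hK]
  rintro ⟨m, c⟩ ⟨⟨hju, hjd, hmε⟩, hc⟩ hmc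
  simp only at hju hjd hmε hc
  by_cases hu : ∀ x ∈ uIcc c (c₀ + ε / 2), (m, x) ∈ transSet γ
  · exact ⟨_, (joinedIn_of_vertical hu).trans hju⟩
  by_cases hd : ∀ x ∈ uIcc c (c₀ - ε / 2), (m, x) ∈ transSet γ
  · exact ⟨_, (joinedIn_of_vertical hd).trans hjd⟩
  exfalso
  push Not at hu hd
  obtain ⟨a, ha, hcrit_a⟩ := hu
  obtain ⟨b, hb, hcrit_b⟩ := hd
  rw [mem_transSet_iff h.contDiff, not_not] at hcrit_a hcrit_b
  rw [Real.ball_eq_Ioo] at hc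
  rw [uIcc_of_le hc.2.le] at ha
  rw [uIcc_of_ge hc.1.le] at hb
  have hab := huniq m hmε a (by rw [Real.ball_eq_Ioo]; constructor <;> linarith [ha.1, ha.2, hc.1])
    b (by rw [Real.ball_eq_Ioo]; constructor <;> linarith [hb.1, hb.2, hc.2]) hcrit_a hcrit_b
  have hac : a = c := le_antisymm (hab ▸ hb.2) ha.1
  exact (mem_transSet_iff h.contDiff m c).1 hmc (hac ▸ hcrit_a)

/-- All transverse lines of slope close to a good slope `m₀` can be joined to transverse lines of
slope `m₀`. -/
lemma GenericPlane.eventually_joined (h : GenericPlane γ) {m₀ : ℝ} (hm : m₀ ∉ badSlopes γ) :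
    ∀ᶠ m in 𝓝 m₀, ∀ c, (m, c) ∈ transSet γ → ∃ c', JoinedIn (transSet γ) (m, c) (m₀, c') := by
  obtain ⟨C, hC⟩ := h.exists_critValue_bound m₀
  have hev := (isCompact_Icc (a := -C) (b := C)).eventually_forall_of_forall_eventually
    (x₀ := m₀) (P := fun m c => (m, c) ∈ transSet γ →
      ∃ c', JoinedIn (transSet γ) (m, c) (m₀, c')) fun c _ => h.eventually_joined_local hm c
  filter_upwards [hev, Metric.closedBall_mem_nhds m₀ one_pos] with m hm₁ hm₂ c hc
  by_cases hcC : |c| ≤ C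
  · exact hm₁ c (abs_le.1 hcC) hc
  · refine ⟨c, joinedIn_of_horizontal fun x hx => (mem_transSet_iff h.contDiff x c).2 fun hx' =>
      hcC (hC x ?_ c hx')⟩
    have := (convex_closedBall m₀ 1).ordConnected.uIcc_subset hm₂
      (Metric.mem_closedBall_self zero_le_one) hx
    simpa [Real.dist_eq] using this

/-- Transverse lines can be moved along intervals of good slopes. -/
lemma GenericPlane.exists_joined_of_disjoint (h : GenericPlane γ) {m r c : ℝ}
    (hd : Disjoint (uIcc m r) (badSlopes γ)) (hc : (m, c) ∈ transSet γ) :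
    ∃ c', JoinedIn (transSet γ) (m, c) (r, c') := by
  have hW := isOpen_transSet h.contDiff h.periodic
  have hsub : uIcc m r ⊆ {x | ∃ c', JoinedIn (transSet γ) (m, c) (x, c')} := by
    refine isPreconnected_uIcc.subset_of_closure_inter_subset ?_
      ⟨m, left_mem_uIcc, c, JoinedIn.refl hc⟩ ?_
    · rw [isOpen_iff_eventually]
      rintro x ⟨c', hx⟩
      filter_upwards [h.eventually_horizontal hx.target_mem] with y hy
      exact ⟨c', hx.trans hy.symm⟩
    · rintro x ⟨hx, hxI⟩
      have hfreq := mem_closure_iff_frequently.1 hx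
      obtain ⟨y, ⟨c', hy⟩, hy'⟩ :=
        (hfreq.and_eventually (h.eventually_joined (disjoint_left.1 hd hxI))).exists
      obtain ⟨c'', hy''⟩ := hy' c' hy.target_mem
      exact ⟨c'', hy.trans hy''⟩
  exact hsub right_mem_uIcc

/-- Finitely many transverse lines represent all transverse lines of good slope. -/
lemma GenericPlane.exists_finite_transSet_reps (h : GenericPlane γ) :
    ∃ R : Set (ℝ × ℝ), R.Finite ∧ ∀ p ∈ transSet γ, p.1 ∉ badSlopes γ →
      ∃ r ∈ R, JoinedIn (transSet γ) p r := by
  obtain ⟨R, hR, hRB⟩ := exists_finite_reps h.finite_badSlopes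
  have hV : ∀ r : ↥(R \ badSlopes γ), ∃ S : Set ℝ, S.Finite ∧
      ∀ c ∉ {c | CritValue γ r c}, ∃ s ∈ S, Disjoint (uIcc c s) {c | CritValue γ r c} :=
    fun r => exists_finite_reps (h.finite_critValue r.2.2)
  choose S hS hSV using hV
  have : Finite ↥(R \ badSlopes γ) := hR.sdiff.to_subtype
  refine ⟨⋃ r : ↥(R \ badSlopes γ), Prod.mk (r : ℝ) '' S r,
    finite_iUnion fun r => (hS r).image _, ?_⟩
  rintro ⟨m, c⟩ hp hm
  obtain ⟨r, hr, hmr⟩ := hRB m hm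
  obtain ⟨c', hc'⟩ := h.exists_joined_of_disjoint hmr hp
  let r' : ↥(R \ badSlopes γ) := ⟨r, hr, disjoint_left.1 hmr right_mem_uIcc⟩
  obtain ⟨s, hs, hcs⟩ := hSV r' c' ((mem_transSet_iff h.contDiff r c').1 hc'.target_mem)
  refine ⟨(r, s), mem_iUnion.2 ⟨r', s, hs, rfl⟩, hc'.trans (joinedIn_of_vertical fun x hx => ?_)⟩
  exact (mem_transSet_iff h.contDiff r x).2 (disjoint_left.1 hcs hx)

/-- Finitely many transverse lines represent all transverse lines, up to paths of transverse
lines. -/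
lemma GenericPlane.exists_finite_transverse_reps (h : GenericPlane γ) :
    ∃ R : Set (ℝ × ℝ × ℝ), R.Finite ∧ ∀ L, TransverseLine γ L →
      ∃ r ∈ R, JoinedIn {L | TransverseLine γ L} L r := by
  obtain ⟨R, hR, hRT⟩ := h.exists_finite_transSet_reps
  have hT := isOpen_transverse h.contDiff h.periodic
  let F : ℝ → ℝ × ℝ → ℝ × ℝ × ℝ := fun e p => e • ((1 : ℝ), p.1, p.2)
  refine ⟨F 1 '' R ∪ F (-1) '' R, (hR.image _).union (hR.image _), fun L hL => ?_⟩
  obtain ⟨ε, hε, hball⟩ := Metric.isOpen_iff.1 hT L hL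
  obtain ⟨M, hML, hM0, hMB⟩ : ∃ M ∈ Metric.ball L ε, M.1 ≠ 0 ∧ M.2.1 / M.1 ∉ badSlopes γ := by
    obtain ⟨a, ha, ha0⟩ : ∃ a ∈ Metric.ball L.1 ε, a ≠ 0 := by
      obtain ⟨a, ha, ha0⟩ := ((infinite_of_mem_nhds L.1 (Metric.ball_mem_nhds _ hε)).sdiff
        (finite_singleton (0 : ℝ))).nonempty
      exact ⟨a, ha, ha0⟩
    obtain ⟨b, hb, hbB⟩ := ((infinite_of_mem_nhds L.2.1 (Metric.ball_mem_nhds _ hε)).sdiff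
      (h.finite_badSlopes.image fun m => m * a)).nonempty
    refine ⟨(a, b, L.2.2), ?_, ha0, fun hbad => hbB ⟨b / a, hbad, div_mul_cancel₀ b ha0⟩⟩
    rw [← Prod.mk.eta (p := L), ← Prod.mk.eta (p := L.2)]
    simp only [← ball_prod_same]
    exact ⟨ha, hb, Metric.mem_ball_self hε⟩
  have hLM : JoinedIn {L | TransverseLine γ L} L M := JoinedIn.of_segment_subset
    (((convex_ball _ ε).segment_subset (Metric.mem_ball_self hε) hML).trans hball)
  have hMT : TransverseLine γ M := hLM.target_mem
  set p : ℝ × ℝ := (M.2.1 / M.1, M.2.2 / M.1) with hp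
  have hMp : M = F M.1 p := by
    ext <;> simp [F, hp] <;> field_simp
  have hpT : p ∈ transSet γ := by
    have := hMT.smul h.contDiff (inv_ne_zero hM0)
    rw [hMp] at this
    simpa [F, smul_smul, hM0, transSet] using this
  obtain ⟨r, hr, hpr⟩ := hRT p hpT hMB
  have hcase : ∀ e : ℝ, 0 < e * M.1 → e ≠ 0 →
      JoinedIn {L | TransverseLine γ L} L (F e r) := by
    intro e he he0
    refine hLM.trans (JoinedIn.trans (y := F e p) ?_ ?_)
    · rw [hMp]
      have hF : Continuous fun x => F x p := by fun_prop
      have hseg : JoinedIn {x : ℝ | x ≠ 0} M.1 e := by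
        refine JoinedIn.of_segment_subset ?_
        rw [segment_eq_uIcc]
        rintro x hx rfl
        rcases mem_uIcc.1 hx with ⟨h1, h2⟩ | ⟨h1, h2⟩ <;> nlinarith
      refine (hseg.map hF).mono ?_
      rintro _ ⟨x, hx, rfl⟩
      exact TransverseLine.smul h.contDiff hpT hx
    · have hF : Continuous (F e) := by fun_prop
      refine (hpr.map hF).mono ?_
      rintro _ ⟨q, hq, rfl⟩
      exact TransverseLine.smul h.contDiff hq he0
  rcases lt_or_gt_of_ne hM0 with hneg | hpos
  · exact ⟨_, Or.inr ⟨r, hr, rfl⟩, hcase (-1) (by linarith) (by norm_num)⟩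
  · exact ⟨_, Or.inl ⟨r, hr, rfl⟩, hcase 1 (by linarith) one_ne_zero⟩

end Joining

lemma LineHomotopic.of_joinedIn {γ : ℝ → ℝ × ℝ} {L M : ℝ × ℝ × ℝ}
    (h : JoinedIn {L | TransverseLine γ L} L M) : LineHomotopic γ L M := by
  obtain ⟨P, hP⟩ := h
  refine ⟨P.extend, P.continuous_extend.continuousOn, P.extend_zero, P.extend_one, fun s hs => ?_⟩
  rw [P.extend_apply hs]
  exact hP _

lemma mk_mem_nonTransverse_iff {γ : ℝ → ℝ × ℝ} (hγ : ContDiff ℝ 2 γ)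
    (L : {L : ℝ × ℝ × ℝ // IsLine L}) :
    Quotient.mk lineSetoid L ∈ nonTransverse γ ↔ ¬ TransverseLine γ L.val := by
  refine ⟨?_, fun h => ⟨L, rfl, h⟩⟩
  rintro ⟨M, hM, hMT⟩ hL
  obtain ⟨c, hc, hcL⟩ := Quotient.exact hM.symm
  exact hMT (hcL ▸ hL.smul hγ hc)

/-- For a generic plane curve, the non-transverse lines form a closed subset of `X₂`. -/
lemma GenericPlane.isClosed_nonTransverse {γ : ℝ → ℝ × ℝ} (h : GenericPlane γ) :
    IsClosed (nonTransverse γ) := by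
  rw [← isOpen_compl_iff]
  refine (isQuotientMap_quot_mk (r := lineSetoid.r)).isOpen_preimage.1 ?_
  convert (isOpen_transverse h.contDiff h.periodic).preimage
    (continuous_subtype_val (p := IsLine)) using 1
  ext L
  exact (mk_mem_nonTransverse_iff h.contDiff L).not.trans not_not

/-- For a generic plane curve, there are finitely many classes of transverse lines. -/
lemma GenericPlane.finite_lineClasses {γ : ℝ → ℝ × ℝ} (h : GenericPlane γ) :
    Finite (LineClasses γ) := by
  obtain ⟨R, hR, hRT⟩ := h.exists_finite_transverse_reps
  have : Finite ↥(R ∩ {L | TransverseLine γ L}) := (hR.inter_of_left _).to_subtype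
  refine Finite.of_surjective (fun r : ↥(R ∩ {L | TransverseLine γ L}) =>
    (Quot.mk _ ⟨r.1, r.2.2⟩ : LineClasses γ)) ?_
  rintro ⟨L, hL⟩
  obtain ⟨r, hr, hLr⟩ := hRT L hL
  exact ⟨⟨r, hr, hLr.target_mem⟩, Quot.sound (LineHomotopic.of_joinedIn hLr.symm)⟩

/-- For a generic plane curve, the space of transverse lines has finitely many components. -/
lemma GenericPlane.finite_connectedComponents {γ : ℝ → ℝ × ℝ} (h : GenericPlane γ) :
    Finite (ConnectedComponents ↥((nonTransverse γ)ᶜ)) := by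
  obtain ⟨R, hR, hRT⟩ := h.exists_finite_transverse_reps
  have : Finite ↥(R ∩ {L | TransverseLine γ L}) := (hR.inter_of_left _).to_subtype
  let Φ : {L | TransverseLine γ L} → ↥((nonTransverse γ)ᶜ) := fun L =>
    ⟨Quotient.mk lineSetoid ⟨L.1, L.2.1⟩,
      fun hL => (mk_mem_nonTransverse_iff h.contDiff _).1 hL L.2⟩
  have hΦ : Continuous Φ :=
    (continuous_quot_mk.comp (continuous_subtype_val.subtype_mk fun L => L.2.1)).subtype_mk _
  refine Finite.of_surjective (fun r : ↥(R ∩ {L | TransverseLine γ L}) =>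
    (Φ ⟨r.1, r.2.2⟩ : ConnectedComponents ↥((nonTransverse γ)ᶜ))) ?_
  intro x
  obtain ⟨⟨y, hy⟩, rfl⟩ := ConnectedComponents.surjective_coe x
  obtain ⟨L, rfl⟩ := Quotient.exists_rep y
  have hL : TransverseLine γ L.val := by
    by_contra hL
    exact hy ((mk_mem_nonTransverse_iff h.contDiff L).2 hL)
  obtain ⟨r, hr, hLr⟩ := hRT L.val hL
  refine ⟨⟨r, hr, hLr.target_mem⟩, ConnectedComponents.coe_eq_coe'.2 ?_⟩
  exact pathComponent_subset_component _ (hLr.joined_subtype.map hΦ)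

/-- For a generic smooth closed curve `γ` in `ℝ³`, the set of planes in `X₂`
not transverse to `γ` is closed, its complement has finitely many connected components, the
transverse planes fall into finitely many equivalence classes, and hence `w₂(γ)` is finite. -/
theorem nonTransverse_closed_and_finitely_many_classes (γ : ℝ → ℝ × ℝ × ℝ)
    (h : GenericSpace γ) :
    IsClosed (nonTransverse (proj γ)) ∧
      Finite (ConnectedComponents ↥((nonTransverse (proj γ))ᶜ)) ∧
      Finite (LineClasses (proj γ)) := by
  have hp := h.2.2
  exact ⟨hp.isClosed_nonTransverse, hp.finite_connectedComponents, hp.finite_lineClasses⟩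

end KWidth
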